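/- For all sufficiently small ε and all sufficiently small perturbations, a parallel k-fission H of S satisfies: within each cluster, order the k points by their coordinate in the common direction d (positions 1 through k from left to right). Then for every halving edge {v,w} of S, each of the k halving edges of H traversing the v-cluster and the w-cluster connects the point in position m of one cluster to the point in position k+1−m of the other cluster, for some m ∈ {1,…,k}, and all values m = 1,…,k occur. Consequently the halving edges graph of H decomposes into parts each of which only involves, in every cluster, the m-th point from the left and the m-th point from the right. -/

import Mathlib

noncomputable section

/-- The plane. -/
abbrev Pt : Type := EuclideanSpace ℝ (Fin 2)

/-- Signed determinant of the triple `(p, q, r)`: positive iff `r` lies on the left of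
the directed line from `p` to `q`. -/
def det2 (p q r : Pt) : ℝ :=
  (q 0 - p 0) * (r 1 - p 1) - (q 1 - p 1) * (r 0 - p 0)

/-- A finite set of points in the plane is in general position if no three of its
(distinct) points are collinear. -/
def GenPos (S : Finset Pt) : Prop :=
  ∀ p ∈ S, ∀ q ∈ S, ∀ r ∈ S, p ≠ q → p ≠ r → q ≠ r →
    ¬ Collinear ℝ ({p, q, r} : Set Pt)

/-- `{p, q}` is a halving edge of `S`: `p, q` are distinct points of `S` and the open
half-planes on the two sides of the line through `p` and `q` each contain exactly
`(|S| - 2)/2` points of `S`. -/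
def HalvingEdge (S : Finset Pt) (p q : Pt) : Prop :=
  p ∈ S ∧ q ∈ S ∧ p ≠ q ∧
    {r ∈ (S : Set Pt) | 0 < det2 p q r}.ncard = (S.card - 2) / 2 ∧
    {r ∈ (S : Set Pt) | det2 p q r < 0}.ncard = (S.card - 2) / 2

/-- The halving edges graph of `S` (as a graph on the whole plane; all vertices
outside `S` are isolated). -/
def halvingGraph (S : Finset Pt) : SimpleGraph Pt :=
  SimpleGraph.fromRel (HalvingEdge S)

/-- The number of halving edges of `S`. -/
def halvingEdgeCount (S : Finset Pt) : ℕ :=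
  {e : Sym2 Pt | ∃ p q, e = s(p, q) ∧ HalvingEdge S p q}.ncard

/-- `H`, together with the cluster map `cl`, is a `k`-fission of `S` within `ε`:
`H` is a set of `k * |S|` points in general position partitioned into clusters
`cl v` of `k` points, one for each `v ∈ S`, with each point of the `v`-cluster
within distance `ε` of `v`. -/
structure IsFission (S : Finset Pt) (k : ℕ) (ε : ℝ) (H : Finset Pt)
    (cl : Pt → Finset Pt) : Prop where
  genPos : GenPos H
  cluster_card : ∀ v ∈ S, (cl v).card = k
  disj : ∀ v ∈ S, ∀ w ∈ S, v ≠ w → Disjoint (cl v) (cl w)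
  union_eq : (H : Set Pt) = ⋃ v ∈ S, (cl v : Set Pt)
  close : ∀ v ∈ S, ∀ x ∈ cl v, dist x v ≤ ε

/-- A fission is plain if no halving edge of `H` has both endpoints in the same cluster. -/
def IsPlain (S : Finset Pt) (H : Finset Pt) (cl : Pt → Finset Pt) : Prop :=
  ∀ v ∈ S, ∀ p ∈ cl v, ∀ q ∈ cl v, ¬ HalvingEdge H p q


local instance : DecidableEq Pt := Classical.decEq _

/-- `H`, with cluster points `c v m` (the `m`-th point of the `v`-cluster, ordered along
the common direction `d`), is a parallel `k`-fission of `S` within `ε`, obtained by a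
perturbation of size at most `δ` of the configuration in which every `v ∈ S` is replaced
by the translated copy `v + t m • d` (`m = 0, …, k-1`) of a fixed set of `k` points on a
line with direction `d`; the direction `d` is not parallel to any segment joining two
points of `S`. -/
structure IsParallelFission (S : Finset Pt) (k : ℕ) (ε δ : ℝ) (d : Pt) (t : Fin k → ℝ)
    (H : Finset Pt) (c : Pt → Fin k → Pt) : Prop where
  d_ne : d ≠ 0
  not_parallel : ∀ v ∈ S, ∀ w ∈ S, v ≠ w → ∀ r : ℝ, w - v ≠ r • d
  t_mono : StrictMono t
  genPos : GenPos H
  card_eq : H.card = k * S.card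
  union_eq : (H : Set Pt) = {x | ∃ v ∈ S, ∃ m : Fin k, x = c v m}
  perturb : ∀ v ∈ S, ∀ m : Fin k, dist (c v m) (v + t m • d) ≤ δ
  close : ∀ v ∈ S, ∀ m : Fin k, dist (c v m) v ≤ ε

/-- The planar cross product. -/
def cross2 (a b : Pt) : ℝ := a 0 * b 1 - a 1 * b 0

/-- The side (`1` left, `-1` right, `0` on the line) of the line `p q` on which `r` lies. -/
def sideSign (p q r : Pt) : ℤ := (SignType.sign (det2 p q r) : ℤ)

lemma exists_smul_of_cross2_eq_zero {a b : Pt} (ha : a ≠ 0) (h : cross2 a b = 0) :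
    ∃ r : ℝ, b = r • a := by
  unfold cross2 at h
  by_cases h0 : a 0 = 0
  · have h1 : a 1 ≠ 0 := by
      intro h1
      apply ha
      ext i
      fin_cases i <;> simp [h0, h1]
    refine ⟨b 1 / a 1, ?_⟩
    ext i
    fin_cases i
    · simp only [h0, zero_mul, zero_sub, neg_eq_zero, mul_eq_zero, h1, false_or] at h
      simp [h0, h]
    · simp [h1]
  · refine ⟨b 0 / a 0, ?_⟩
    ext i
    fin_cases i
    · simp [h0]
    · simp only [Fin.mk_one, PiLp.smul_apply, smul_eq_mul]
      field_simp
      linarith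

lemma det2_eq_cross2 (p q r : Pt) : det2 p q r = cross2 (q - p) (r - p) := rfl

lemma det2_self_left (p q : Pt) : det2 p q p = 0 := by
  simp [det2]

lemma det2_self_right (p q : Pt) : det2 p q q = 0 := by
  unfold det2; ring

lemma sideSign_self_left (p q : Pt) : sideSign p q p = 0 := by
  simp [sideSign, det2_self_left]

lemma sideSign_self_right (p q : Pt) : sideSign p q q = 0 := by
  simp [sideSign, det2_self_right]

lemma GenPos.det2_ne_zero {S : Finset Pt} (hS : GenPos S) {p q r : Pt} (hp : p ∈ S) (hq : q ∈ S)
    (hr : r ∈ S) (hpq : p ≠ q) (hpr : p ≠ r) (hqr : q ≠ r) : det2 p q r ≠ 0 := by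
  intro h
  obtain ⟨l, hl⟩ := exists_smul_of_cross2_eq_zero (sub_ne_zero.2 hpq.symm)
    ((det2_eq_cross2 p q r).symm.trans h)
  refine hS p hp q hq r hr hpq hpr hqr ?_
  rw [collinear_iff_of_mem (p₀ := p) (by simp)]
  refine ⟨q - p, ?_⟩
  simp only [Set.mem_insert_iff, Set.mem_singleton_iff, forall_eq_or_imp, forall_eq]
  refine ⟨⟨0, by simp⟩, ⟨1, by simp⟩, ⟨l, ?_⟩⟩
  simp [← hl]

lemma sideSign_eq (p q r : Pt) :
    sideSign p q r = (if 0 < det2 p q r then 1 else 0) - (if det2 p q r < 0 then 1 else 0) := by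
  unfold sideSign
  rcases lt_trichotomy (det2 p q r) 0 with h | h | h
  · simp [h, h.not_gt]
  · simp [h]
  · simp [h, h.not_gt]

lemma abs_sideSign_le_one (p q r : Pt) : |sideSign p q r| ≤ 1 := by
  unfold sideSign
  cases SignType.sign (det2 p q r) <;> simp

lemma sideSign_emod_two {p q r : Pt} (h : det2 p q r ≠ 0) : sideSign p q r % 2 = 1 := by
  unfold sideSign
  rcases lt_or_gt_of_ne h with h | h <;> simp [h]

lemma sum_sideSign_emod_two {A : Finset Pt} {p q : Pt} (h : ∀ r ∈ A, det2 p q r ≠ 0) :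
    (∑ r ∈ A, sideSign p q r) % 2 = A.card % 2 := by
  rw [Finset.sum_int_mod, Finset.sum_congr rfl fun r hr => sideSign_emod_two (h r hr)]
  simp

lemma sum_sideSign_erase (S : Finset Pt) (p q : Pt) :
    ∑ r ∈ (S.erase p).erase q, sideSign p q r = ∑ r ∈ S, sideSign p q r := by
  rw [Finset.sum_erase _ (sideSign_self_right p q), Finset.sum_erase _ (sideSign_self_left p q)]

lemma card_erase_erase {S : Finset Pt} {p q : Pt} (hp : p ∈ S) (hq : q ∈ S) (hpq : p ≠ q) :
    ((S.erase p).erase q).card + 2 = S.card := by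
  have h1 := Finset.card_erase_add_one (s := S.erase p) (a := q)
    (Finset.mem_erase.2 ⟨hpq.symm, hq⟩)
  have h2 := Finset.card_erase_add_one hp
  omega

lemma GenPos.sum_sideSign_emod_two {S : Finset Pt} (hS : GenPos S) (hcard : Even S.card)
    {p q : Pt} (hp : p ∈ S) (hq : q ∈ S) (hpq : p ≠ q) :
    (∑ r ∈ S, sideSign p q r) % 2 = 0 := by
  rw [← sum_sideSign_erase, _root_.sum_sideSign_emod_two]
  · have := card_erase_erase hp hq hpq
    obtain ⟨a, ha⟩ := hcard
    omega
  · intro r hr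
    simp only [Finset.mem_erase] at hr
    exact hS.det2_ne_zero hp hq hr.2.2 hpq (Ne.symm hr.2.1) (Ne.symm hr.1)

lemma halvingEdge_iff_sum_sideSign {S : Finset Pt} (hS : GenPos S) (hcard : Even S.card)
    {p q : Pt} (hp : p ∈ S) (hq : q ∈ S) (hpq : p ≠ q) :
    HalvingEdge S p q ↔ ∑ r ∈ S, sideSign p q r = 0 := by
  have hl : {r ∈ (S : Set Pt) | 0 < det2 p q r}.ncard
      = (S.filter fun r => 0 < det2 p q r).card := by
    rw [← Set.ncard_coe_finset, Finset.coe_filter]; rfl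
  have hr : {r ∈ (S : Set Pt) | det2 p q r < 0}.ncard
      = (S.filter fun r => det2 p q r < 0).card := by
    rw [← Set.ncard_coe_finset, Finset.coe_filter]; rfl
  have hsum : ∑ r ∈ S, sideSign p q r = ((S.filter fun r => 0 < det2 p q r).card : ℤ)
      - (S.filter fun r => det2 p q r < 0).card := by
    simp only [sideSign_eq, Finset.sum_sub_distrib, Finset.sum_boole]
  have hunion : (S.filter fun r => 0 < det2 p q r) ∪ (S.filter fun r => det2 p q r < 0)
      = (S.erase p).erase q := by
    ext r
    simp only [Finset.mem_union, Finset.mem_filter, Finset.mem_erase]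
    constructor
    · rintro (⟨h, h'⟩ | ⟨h, h'⟩) <;> refine ⟨?_, ?_, h⟩ <;> rintro rfl <;>
        simp [det2_self_left, det2_self_right] at h'
    · rintro ⟨h1, h2, h3⟩
      rcases lt_or_gt_of_ne (hS.det2_ne_zero hp hq h3 hpq (Ne.symm h2) (Ne.symm h1)) with h | h
      · exact Or.inr ⟨h3, h⟩
      · exact Or.inl ⟨h3, h⟩
  have hdisj : Disjoint (S.filter fun r => 0 < det2 p q r)
      (S.filter fun r => det2 p q r < 0) := by
    rw [Finset.disjoint_filter]
    intro r _ h
    exact h.not_gt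
  have htot := Finset.card_union_of_disjoint hdisj
  rw [hunion] at htot
  have hcard2 := card_erase_erase hp hq hpq
  obtain ⟨a, ha⟩ := hcard
  rw [hsum]
  simp only [HalvingEdge, hl, hr]
  constructor
  · rintro ⟨-, -, -, h1, h2⟩
    omega
  · intro h
    refine ⟨hp, hq, hpq, ?_, ?_⟩ <;> omega

/-- The side relations of a finite configuration are stable under small perturbations. -/
lemma exists_pos_sideSign_stable {ι : Type*} [Fintype ι] (f : ι → Pt) :
    ∃ η > 0, ∀ g : ι → Pt, (∀ i, dist (g i) (f i) ≤ η) → ∀ i j l,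
      det2 (f i) (f j) (f l) ≠ 0 → sideSign (g i) (g j) (g l) = sideSign (f i) (f j) (f l) := by
  have hev : ∀ᶠ g in nhds f, ∀ i j l, det2 (f i) (f j) (f l) ≠ 0 →
      sideSign (g i) (g j) (g l) = sideSign (f i) (f j) (f l) := by
    simp only [Filter.eventually_all]
    intro i j l h
    have hc : Continuous fun g : ι → Pt => det2 (g i) (g j) (g l) := by
      unfold det2
      fun_prop
    rcases lt_or_gt_of_ne h with h | h
    · filter_upwards [hc.continuousAt.eventually_lt continuousAt_const h] with g hg
      simp [sideSign, hg, h]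
    · filter_upwards [continuousAt_const.eventually_lt hc.continuousAt h] with g hg
      simp [sideSign, hg, h]
  obtain ⟨η, hη, h⟩ := Metric.eventually_nhds_iff.1 hev
  refine ⟨η / 2, half_pos hη, fun g hg => h ?_⟩
  exact ((dist_pi_le_iff (half_pos hη).le).2 hg).trans_lt (half_lt_self hη)

lemma sum_sign_sub {k : ℕ} {t : Fin k → ℝ} (ht : StrictMono t) (m : Fin k) :
    ∑ j, ((SignType.sign (t j - t m) : SignType) : ℤ) = (k : ℤ) - 1 - 2 * (m : ℕ) := by
  have h : ∀ j, ((SignType.sign (t j - t m) : SignType) : ℤ)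
      = (if m < j then 1 else 0) - (if j < m then 1 else 0) := by
    intro j
    rcases lt_trichotomy j m with h | rfl | h
    · have : t j - t m < 0 := sub_neg.2 (ht h)
      simp [sign_neg this, h, h.not_gt]
    · simp
    · have : 0 < t j - t m := sub_pos.2 (ht h)
      simp [sign_pos this, h, h.not_gt]
  simp only [h, Finset.sum_sub_distrib, Finset.sum_boole]
  have h1 : (Finset.univ.filter fun j => m < j) = Finset.Ioi m := by ext; simp
  have h2 : (Finset.univ.filter fun j => j < m) = Finset.Iio m := by ext; simp
  rw [h1, h2, Fin.card_Ioi, Fin.card_Iio]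
  have := m.2
  omega

lemma det2_translate_left (v w d : Pt) (a b s : ℝ) :
    det2 (v + a • d) (w + b • d) (v + s • d) = (s - a) * cross2 (w - v) d := by
  simp [det2, cross2]; ring

lemma det2_translate_right (v w d : Pt) (a b s : ℝ) :
    det2 (v + a • d) (w + b • d) (w + s • d) = (s - b) * cross2 (w - v) d := by
  simp [det2, cross2]; ring

lemma det2_translate_same (v x d : Pt) (a b s : ℝ) :
    det2 (v + a • d) (v + b • d) (x + s • d) = (b - a) * cross2 d (x - v) := by
  simp [det2, cross2]; ring

lemma cross2_comm (a b : Pt) : cross2 a b = -cross2 b a := by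
  unfold cross2; ring

lemma add_eq_sub_one_iff_rev {k : ℕ} (m m' : Fin k) :
    (m : ℤ) + m' = k - 1 ↔ m' = m.rev := by
  rw [Fin.ext_iff, Fin.val_rev]
  have := m.2
  omega

section Fission

variable {S : Finset Pt} {k : ℕ} {ε δ : ℝ} {d : Pt} {t : Fin k → ℝ} {H : Finset Pt}
  {c : Pt → Fin k → Pt}

lemma IsParallelFission.cross2_ne_zero (h : IsParallelFission S k ε δ d t H c) {v w : Pt}
    (hv : v ∈ S) (hw : w ∈ S) (hvw : v ≠ w) : cross2 d (w - v) ≠ 0 := by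
  intro h0
  obtain ⟨r, hr⟩ := exists_smul_of_cross2_eq_zero h.d_ne h0
  exact h.not_parallel v hv w hw hvw r hr

lemma IsParallelFission.eq_image (h : IsParallelFission S k ε δ d t H c) :
    H = (S ×ˢ (Finset.univ : Finset (Fin k))).image fun i => c i.1 i.2 := by
  ext x
  rw [← Finset.mem_coe, h.union_eq]
  simp only [Set.mem_ofPred_eq, Finset.mem_image, Finset.mem_product, Finset.mem_univ, and_true,
    Prod.exists]
  constructor
  · rintro ⟨v, hv, m, rfl⟩
    exact ⟨v, m, hv, rfl⟩
  · rintro ⟨v, m, hv, rfl⟩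
    exact ⟨v, hv, m, rfl⟩

lemma IsParallelFission.mem (h : IsParallelFission S k ε δ d t H c) {v : Pt} (hv : v ∈ S)
    (m : Fin k) : c v m ∈ H := by
  rw [← Finset.mem_coe, h.union_eq]
  exact ⟨v, hv, m, rfl⟩

lemma IsParallelFission.injOn (h : IsParallelFission S k ε δ d t H c) :
    Set.InjOn (fun i : Pt × Fin k => c i.1 i.2) (S ×ˢ (Finset.univ : Finset (Fin k)) :
      Finset (Pt × Fin k)) := by
  rw [← Finset.card_image_iff, ← h.eq_image, h.card_eq, Finset.card_product, Finset.card_fin,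
    mul_comm]

lemma IsParallelFission.inj (h : IsParallelFission S k ε δ d t H c) {v w : Pt} (hv : v ∈ S)
    (hw : w ∈ S) {m m' : Fin k} (he : c v m = c w m') : v = w ∧ m = m' := by
  have := h.injOn (x₁ := (v, m)) (x₂ := (w, m')) (by simp [hv]) (by simp [hw]) he
  simpa using this

lemma IsParallelFission.sum_eq (h : IsParallelFission S k ε δ d t H c) (F : Pt → ℤ) :
    ∑ r ∈ H, F r = ∑ x ∈ S, ∑ j, F (c x j) := by
  rw [h.eq_image, Finset.sum_image h.injOn, Finset.sum_product]

/-- The side relations of the fission are those of the original set, for points in three distinct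
clusters, and those of the unperturbed configuration, whenever the latter are nondegenerate. -/
structure SidesStable (S : Finset Pt) (k : ℕ) (d : Pt) (t : Fin k → ℝ) (c : Pt → Fin k → Pt) :
    Prop where
  distinct : ∀ v ∈ S, ∀ w ∈ S, ∀ x ∈ S, ∀ m m' j : Fin k, det2 v w x ≠ 0 →
    sideSign (c v m) (c w m') (c x j) = sideSign v w x
  nondegenerate : ∀ v ∈ S, ∀ w ∈ S, ∀ x ∈ S, ∀ m m' j : Fin k,
    det2 (v + t m • d) (w + t m' • d) (x + t j • d) ≠ 0 →
      sideSign (c v m) (c w m') (c x j) =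
        sideSign (v + t m • d) (w + t m' • d) (x + t j • d)

lemma IsParallelFission.sum_sideSign_of_ne (h : IsParallelFission S k ε δ d t H c)
    (hs : SidesStable S k d t c) (hS : GenPos S) {v w : Pt} (hv : v ∈ S) (hw : w ∈ S)
    (hvw : v ≠ w) (m m' : Fin k) :
    ∑ r ∈ H, sideSign (c v m) (c w m') r = k * ∑ x ∈ S, sideSign v w x +
      2 * (SignType.sign (cross2 (w - v) d) : ℤ) * (k - 1 - m - m') := by
  have hcr : cross2 (w - v) d ≠ 0 := by
    rw [cross2_comm, neg_ne_zero]
    exact h.cross2_ne_zero hv hw hvw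
  have hvS : ∑ j, sideSign (c v m) (c w m') (c v j) =
      ((k : ℤ) - 1 - 2 * (m : ℕ)) * (SignType.sign (cross2 (w - v) d) : ℤ) := by
    rw [← sum_sign_sub h.t_mono m, Finset.sum_mul]
    refine Finset.sum_congr rfl fun j _ => ?_
    by_cases hj : j = m
    · subst hj
      simp [sideSign_self_left]
    · have hne : t j - t m ≠ 0 := sub_ne_zero.2 (h.t_mono.injective.ne hj)
      rw [hs.nondegenerate v hv w hw v hv]
      · rw [sideSign, det2_translate_left, sign_mul, SignType.coe_mul]
      · rw [det2_translate_left]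
        exact mul_ne_zero hne hcr
  have hwS : ∑ j, sideSign (c v m) (c w m') (c w j) =
      ((k : ℤ) - 1 - 2 * (m' : ℕ)) * (SignType.sign (cross2 (w - v) d) : ℤ) := by
    rw [← sum_sign_sub h.t_mono m', Finset.sum_mul]
    refine Finset.sum_congr rfl fun j _ => ?_
    by_cases hj : j = m'
    · subst hj
      simp [sideSign_self_right]
    · have hne : t j - t m' ≠ 0 := sub_ne_zero.2 (h.t_mono.injective.ne hj)
      rw [hs.nondegenerate v hv w hw w hw]
      · rw [sideSign, det2_translate_right, sign_mul, SignType.coe_mul]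
      · rw [det2_translate_right]
        exact mul_ne_zero hne hcr
  have hrest : ∑ x ∈ (S.erase v).erase w, ∑ j, sideSign (c v m) (c w m') (c x j) =
      k * ∑ x ∈ S, sideSign v w x := by
    rw [← sum_sideSign_erase, Finset.mul_sum]
    refine Finset.sum_congr rfl fun x hx => ?_
    simp only [Finset.mem_erase] at hx
    rw [Finset.sum_congr rfl fun j _ => hs.distinct v hv w hw x hx.2.2 m m' j
      (hS.det2_ne_zero hv hw hx.2.2 hvw (Ne.symm hx.2.1) (Ne.symm hx.1))]
    simp
  rw [h.sum_eq, ← Finset.add_sum_erase S _ hv,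
    ← Finset.add_sum_erase (S.erase v) _ (Finset.mem_erase.2 ⟨hvw.symm, hw⟩), hvS, hwS, hrest]
  ring

lemma IsParallelFission.sum_sideSign_same_ne_zero (h : IsParallelFission S k ε δ d t H c)
    (hs : SidesStable S k d t c) (hcard : Even S.card) {v : Pt} (hv : v ∈ S)
    {m m' : Fin k} (hm : m ≠ m') : ∑ r ∈ H, sideSign (c v m) (c v m') r ≠ 0 := by
  have hne : t m' - t m ≠ 0 := sub_ne_zero.2 (h.t_mono.injective.ne hm.symm)
  have hdet : ∀ x ∈ S.erase v, ∀ j,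
      det2 (v + t m • d) (v + t m' • d) (x + t j • d) ≠ 0 := by
    intro x hx j
    rw [Finset.mem_erase] at hx
    rw [det2_translate_same]
    exact mul_ne_zero hne (h.cross2_ne_zero hv hx.2 (Ne.symm hx.1))
  have hrest : ∑ x ∈ S.erase v, ∑ j, sideSign (c v m) (c v m') (c x j) =
      k * ∑ x ∈ S.erase v, sideSign (v + t m • d) (v + t m' • d) (x + t m • d) := by
    rw [Finset.mul_sum]
    refine Finset.sum_congr rfl fun x hx => ?_
    have hx' := (Finset.mem_erase.1 hx).2
    rw [Finset.sum_congr rfl fun j _ =>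
      (hs.nondegenerate v hv v hv x hx' m m' j (hdet x hx j)).trans
        (show _ = sideSign (v + t m • d) (v + t m' • d) (x + t m • d) by
          simp only [sideSign, det2_translate_same])]
    simp
  have hodd : (∑ x ∈ S.erase v, sideSign (v + t m • d) (v + t m' • d) (x + t m • d)) % 2 = 1 := by
    rw [Finset.sum_int_mod,
      Finset.sum_congr rfl fun x hx => sideSign_emod_two (hdet x hx m)]
    have := Finset.card_erase_add_one hv
    obtain ⟨a, ha⟩ := hcard
    simp only [Finset.sum_const, nsmul_eq_mul, mul_one]
    omega
  have hself : |∑ j, sideSign (c v m) (c v m') (c v j)| ≤ (k : ℤ) - 1 := by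
    rw [← Finset.sum_erase _ (a := m) (sideSign_self_left _ _)]
    refine (Finset.abs_sum_le_sum_abs _ _).trans
      ((Finset.sum_le_sum fun j _ => abs_sideSign_le_one _ _ _).trans ?_)
    have := Finset.card_erase_add_one (Finset.mem_univ m)
    rw [Finset.card_fin] at this
    simp only [Finset.sum_const, nsmul_eq_mul, mul_one]
    omega
  rw [h.sum_eq, ← Finset.add_sum_erase S _ hv, hrest]
  generalize ∑ x ∈ S.erase v, sideSign (v + t m • d) (v + t m' • d) (x + t m • d) = E at *
  generalize ∑ j, sideSign (c v m) (c v m') (c v j) = A at *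
  intro h0
  rw [abs_le] at hself
  have hE : E ≤ -1 ∨ 1 ≤ E := by omega
  rcases hE with hE | hE <;> nlinarith

lemma IsParallelFission.even_card (h : IsParallelFission S k ε δ d t H c)
    (hcard : Even S.card) : Even H.card := by
  rw [h.card_eq]
  exact hcard.mul_left k

/-- The halving edges of the fission join opposite positions in two clusters joined by a halving
edge of the original set. -/
lemma IsParallelFission.halvingEdge_iff (h : IsParallelFission S k ε δ d t H c)
    (hs : SidesStable S k d t c) (hS : GenPos S) (hcard : Even S.card) {v w : Pt} (hv : v ∈ S)
    (hw : w ∈ S) (m m' : Fin k) :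
    HalvingEdge H (c v m) (c w m') ↔ HalvingEdge S v w ∧ m' = m.rev := by
  by_cases hvw : v = w
  · subst hvw
    refine iff_of_false (fun he => ?_) fun he => he.1.2.2.1 rfl
    have hm : m ≠ m' := by
      rintro rfl
      exact he.2.2.1 rfl
    exact h.sum_sideSign_same_ne_zero hs hcard hv hm
      ((halvingEdge_iff_sum_sideSign h.genPos (h.even_card hcard) he.1 he.2.1 he.2.2.1).1 he)
  · have hne : c v m ≠ c w m' := fun he => hvw (h.inj hv hw he).1
    have hcr : cross2 (w - v) d ≠ 0 := by
      rw [cross2_comm, neg_ne_zero]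
      exact h.cross2_ne_zero hv hw hvw
    rw [halvingEdge_iff_sum_sideSign h.genPos (h.even_card hcard) (h.mem hv m) (h.mem hw m') hne,
      halvingEdge_iff_sum_sideSign hS hcard hv hw hvw, h.sum_sideSign_of_ne hs hS hv hw hvw,
      ← add_eq_sub_one_iff_rev]
    have hpar := hS.sum_sideSign_emod_two hcard hv hw hvw
    generalize ∑ x ∈ S, sideSign v w x = D at *
    have hm := m.2
    have hm' := m'.2
    have hsgn : (SignType.sign (cross2 (w - v) d) : ℤ) = 1 ∨
        (SignType.sign (cross2 (w - v) d) : ℤ) = -1 := by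
      rcases lt_or_gt_of_ne hcr with h | h <;> simp [h]
    have hD : k * D + 2 * (SignType.sign (cross2 (w - v) d) : ℤ) * (k - 1 - m - m') = 0 →
        D = 0 := by
      intro h0
      by_contra hD
      have hD' : D ≤ -2 ∨ 2 ≤ D := by omega
      rcases hsgn with hsgn | hsgn <;> rw [hsgn] at h0 <;> rcases hD' with hD' | hD' <;> nlinarith
    constructor
    · intro h0
      have hD0 := hD h0
      refine ⟨hD0, ?_⟩
      rcases hsgn with hsgn | hsgn <;> rw [hsgn, hD0] at h0 <;> linarith
    · rintro ⟨hD0, hmm⟩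
      rw [hD0, show (k : ℤ) - 1 - m - m' = 0 by linarith]
      simp

lemma IsParallelFission.eq_or_eq_rev_of_reachable (h : IsParallelFission S k ε δ d t H c)
    (hs : SidesStable S k d t c) (hS : GenPos S) (hcard : Even S.card) {v : Pt} (hv : v ∈ S)
    (m : Fin k) {y : Pt} (hr : (halvingGraph H).Reachable (c v m) y) :
    ∃ w ∈ S, ∃ m', y = c w m' ∧ (m' = m ∨ m' = m.rev) := by
  rw [SimpleGraph.reachable_iff_reflTransGen] at hr
  induction hr with
  | refl => exact ⟨v, hv, m, rfl, Or.inl rfl⟩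
  | @tail y z _ hadj ih =>
    obtain ⟨w, hw, m', rfl, hm'⟩ := ih
    obtain ⟨-, hadj⟩ := (SimpleGraph.fromRel_adj _ _ _).1 hadj
    have hz : z ∈ (H : Set Pt) := hadj.elim (fun h => h.2.1) fun h => h.1
    rw [h.union_eq] at hz
    obtain ⟨x, hx, j, rfl⟩ := hz
    rw [h.halvingEdge_iff hs hS hcard hw hx, h.halvingEdge_iff hs hS hcard hx hw] at hadj
    refine ⟨x, hx, j, rfl, ?_⟩
    have hj : j = m'.rev := by
      rcases hadj with ⟨-, hj⟩ | ⟨-, hj⟩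
      · exact hj
      · rw [hj, Fin.rev_rev]
    rcases hm' with rfl | rfl
    · exact Or.inr hj
    · exact Or.inl (by rw [hj, Fin.rev_rev])

end Fission

theorem stmt14 (S : Finset Pt) (hS : GenPos S) (hcard : Even S.card)
    (k : ℕ) (hk : 1 ≤ k) (d : Pt) (hd : d ≠ 0)
    (hpar : ∀ v ∈ S, ∀ w ∈ S, v ≠ w → ∀ r : ℝ, w - v ≠ r • d) :
    ∃ ε₀ > 0, ∀ ε : ℝ, 0 < ε → ε ≤ ε₀ →
      ∀ t : Fin k → ℝ, StrictMono t →
        ∃ δ₀ > 0, ∀ δ : ℝ, 0 < δ → δ ≤ δ₀ →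
          ∀ (H : Finset Pt) (c : Pt → Fin k → Pt),
            IsParallelFission S k ε δ d t H c →
              (∀ v ∈ S, ∀ w ∈ S, HalvingEdge S v w →
                ∀ m m' : Fin k, (HalvingEdge H (c v m) (c w m') ↔ m' = m.rev)) ∧
              (∀ v ∈ S, ∀ w ∈ S, ∀ m m' : Fin k,
                (halvingGraph H).Reachable (c v m) (c w m') →
                  m' = m ∨ m' = m.rev) := by
  obtain ⟨ε₀, hε₀, hεs⟩ := exists_pos_sideSign_stable fun i : S × Fin k => (i.1 : Pt)
  refine ⟨ε₀, hε₀, fun ε _ hε t _ => ?_⟩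
  obtain ⟨δ₀, hδ₀, hδs⟩ :=
    exists_pos_sideSign_stable fun i : S × Fin k => (i.1 : Pt) + t i.2 • d
  refine ⟨δ₀, hδ₀, fun δ _ hδ H c h => ?_⟩
  have hs : SidesStable S k d t c := by
    constructor
    · intro v hv w hw x hx m m' j hne
      exact hεs (fun i => c i.1 i.2) (fun i => (h.close _ i.1.2 i.2).trans hε)
        (⟨v, hv⟩, m) (⟨w, hw⟩, m') (⟨x, hx⟩, j) hne
    · intro v hv w hw x hx m m' j hne
      exact hδs (fun i => c i.1 i.2) (fun i => (h.perturb _ i.1.2 i.2).trans hδ)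
        (⟨v, hv⟩, m) (⟨w, hw⟩, m') (⟨x, hx⟩, j) hne
  constructor
  · intro v hv w hw he m m'
    rw [h.halvingEdge_iff hs hS hcard hv hw]
    exact and_iff_right he
  · intro v hv w hw m m' hr
    obtain ⟨x, hx, j, hj, hjm⟩ := h.eq_or_eq_rev_of_reachable hs hS hcard hv m hr
    rw [(h.inj hw hx hj).2]
    exact hjm


end
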